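/- Let H be a weak bialgebra over k and A a right H-comodule algebra with coinvariant subalgebra B such that the Galois map β : A⊗_B A → (A⊗H)ρ(1) is bijective. For h ∈ H write β^{-1}(1₍₀₎ ⊗ h1₍₁₎) = Σ_i ℓ_i(h) ⊗_B r_i(h). Then the following identities hold in A⊗H for all h ∈ H: Σ_i ℓ_i(h₍₁₎)₍₀₎ r_i(h₍₁₎) ⊗ ℓ_i(h₍₁₎)₍₁₎ h₍₂₎ = 1₍₀₎ ⊗ 1₍₁₎Π^R(h), and Σ_i ℓ_i(h₍₂₎)₍₀₎ r_i(h₍₂₎) ⊗ h₍₁₎ ℓ_i(h₍₂₎)₍₁₎ = 1₍₀₎ ⊗ Π^L(h1₍₁₎). (These expressions are well defined because, for each x ∈ H, the maps a⊗a′ ↦ a₍₀₎a′ ⊗ a₍₁₎x and a⊗a′ ↦ a₍₀₎a′ ⊗ x a₍₁₎ descend from A⊗_k A to A⊗_B A.) -/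

import Mathlib

noncomputable section

open TensorProduct LinearMap

/-- A weak bialgebra over a field `k`: a finite-dimensional `k`-algebra with a `k`-coalgebra
structure whose comultiplication is multiplicative, with the weakened unit and counit axioms. -/
structure WeakBialgebra (k : Type*) [Field k] (H : Type*) [Ring H] [Algebra k H]
    [FiniteDimensional k H] where
  comul : H →ₗ[k] H ⊗[k] H
  counit : H →ₗ[k] k
  coassoc : ∀ x : H,
    (TensorProduct.assoc k H H H) ((rTensor H comul) (comul x)) = (lTensor H comul) (comul x)
  rTensor_counit_comul : ∀ x : H, (TensorProduct.lid k H) ((rTensor H counit) (comul x)) = x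
  lTensor_counit_comul : ∀ x : H, (TensorProduct.rid k H) ((lTensor H counit) (comul x)) = x
  comul_mul : ∀ a b : H, comul (a * b) = comul a * comul b
  -- `1₍₁₎ ⊗ 1₍₂₎ ⊗ 1₍₃₎ = (Δ(1) ⊗ 1)(1 ⊗ Δ(1)) = (1 ⊗ Δ(1))(Δ(1) ⊗ 1)`
  weak_one₁ : (lTensor H comul) (comul 1)
    = (TensorProduct.assoc k H H H) ((comul 1) ⊗ₜ[k] (1 : H)) * ((1 : H) ⊗ₜ[k] (comul 1))
  weak_one₂ : (lTensor H comul) (comul 1)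
    = ((1 : H) ⊗ₜ[k] (comul 1)) * (TensorProduct.assoc k H H H) ((comul 1) ⊗ₜ[k] (1 : H))
  -- `ε(abc) = ε(ab₍₁₎)ε(b₍₂₎c) = ε(ab₍₂₎)ε(b₍₁₎c)`
  weak_counit₁ : ∀ a b c : H, counit (a * b * c)
    = (LinearMap.mul' k k)
        ((TensorProduct.map (counit ∘ₗ mulLeft k a) (counit ∘ₗ mulRight k c)) (comul b))
  weak_counit₂ : ∀ a b c : H, counit (a * b * c)
    = (LinearMap.mul' k k)
        ((TensorProduct.map (counit ∘ₗ mulRight k c) (counit ∘ₗ mulLeft k a)) (comul b))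

namespace WeakBialgebra

variable {k : Type*} [Field k] {H : Type*} [Ring H] [Algebra k H] [FiniteDimensional k H]
variable (wb : WeakBialgebra k H)

/-- `ε ⊗ id : H ⊗ H → H`. -/
def εid : H ⊗[k] H →ₗ[k] H := (TensorProduct.lid k H).toLinearMap ∘ₗ rTensor H wb.counit

/-- `id ⊗ ε : H ⊗ H → H`. -/
def idε : H ⊗[k] H →ₗ[k] H := (TensorProduct.rid k H).toLinearMap ∘ₗ lTensor H wb.counit

/-- `Π^L(x) = ε(1₍₁₎x) 1₍₂₎`. -/
def projL : H →ₗ[k] H :=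
  wb.εid ∘ₗ mulLeft k (wb.comul 1) ∘ₗ (TensorProduct.mk k H H).flip 1

/-- `Π^R(x) = 1₍₁₎ ε(x1₍₂₎)`. -/
def projR : H →ₗ[k] H :=
  wb.idε ∘ₗ mulRight k (wb.comul 1) ∘ₗ TensorProduct.mk k H H 1

/-- `Π̄^L(x) = 1₍₁₎ ε(1₍₂₎x)`. -/
def projBarL : H →ₗ[k] H :=
  wb.idε ∘ₗ mulLeft k (wb.comul 1) ∘ₗ TensorProduct.mk k H H 1

/-- `Π̄^R(x) = ε(x1₍₁₎) 1₍₂₎`. -/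
def projBarR : H →ₗ[k] H :=
  wb.εid ∘ₗ mulRight k (wb.comul 1) ∘ₗ (TensorProduct.mk k H H).flip 1

/-- The antipode axioms for a weak Hopf algebra: `S(x₍₁₎)x₍₂₎ = Π^R(x)`,
`x₍₁₎S(x₍₂₎) = Π^L(x)` and `S(x₍₁₎)x₍₂₎S(x₍₃₎) = S(x)`. -/
structure IsAntipode (S : H →ₗ[k] H) : Prop where
  antipode_left : ∀ x : H, LinearMap.mul' k H ((rTensor H S) (wb.comul x)) = wb.projR x
  antipode_right : ∀ x : H, LinearMap.mul' k H ((lTensor H S) (wb.comul x)) = wb.projL x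
  antipode_mid : ∀ x : H,
    LinearMap.mul' k H
      ((TensorProduct.map (LinearMap.mul' k H ∘ₗ rTensor H S) S)
        ((rTensor H wb.comul) (wb.comul x))) = S x

end WeakBialgebra

/-- A right `H`-comodule algebra over a weak bialgebra `H`. -/
structure ComodAlg {k : Type*} [Field k] {H : Type*} [Ring H] [Algebra k H]
    [FiniteDimensional k H] (wb : WeakBialgebra k H)
    (A : Type*) [Ring A] [Algebra k A] where
  ρ : A →ₗ[k] A ⊗[k] H
  coassoc : ∀ a : A,
    (TensorProduct.assoc k A H H) ((rTensor H ρ) (ρ a)) = (lTensor A wb.comul) (ρ a)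
  counital : ∀ a : A, (TensorProduct.rid k A) ((lTensor A wb.counit) (ρ a)) = a
  mul : ∀ a b : A, ρ (a * b) = ρ a * ρ b
  piL : ∀ a : A, (lTensor A wb.projL) (ρ a) = ρ 1 * (a ⊗ₜ[k] (1 : H))
  pibarR : ∀ a : A, (lTensor A wb.projBarR) (ρ a) = (a ⊗ₜ[k] (1 : H)) * ρ 1

namespace ComodAlg

variable {k : Type*} [Field k] {H : Type*} [Ring H] [Algebra k H] [FiniteDimensional k H]
variable {wb : WeakBialgebra k H} {A : Type*} [Ring A] [Algebra k A]

/-- The coinvariant subalgebra `B = {b ∈ A : ρ(b) = 1₍₀₎b ⊗ 1₍₁₎}`. -/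
def coinv (ca : ComodAlg wb A) : Set A := {b | ca.ρ b = ca.ρ 1 * (b ⊗ₜ[k] (1 : H))}

/-- The `B`-balancing relations in `A ⊗_k A`, realizing `A ⊗_B A`. -/
def rel (ca : ComodAlg wb A) : Submodule k (A ⊗[k] A) :=
  Submodule.span k
    {z | ∃ a a' b : A, b ∈ ca.coinv ∧ z = (a * b) ⊗ₜ[k] a' - a ⊗ₜ[k] (b * a')}

/-- `A ⊗_B A`. -/
abbrev QA (ca : ComodAlg wb A) := (A ⊗[k] A) ⧸ ca.rel

/-- The canonical quotient map `A ⊗_k A → A ⊗_B A`. -/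
def mkA (ca : ComodAlg wb A) : A ⊗[k] A →ₗ[k] ca.QA := ca.rel.mkQ

end ComodAlg

namespace WeakBialgebra

variable {k : Type*} [Field k] {H : Type*} [Ring H] [Algebra k H] [FiniteDimensional k H]
variable (wb : WeakBialgebra k H)

@[simp] lemma εid_tmul (x y : H) : wb.εid (x ⊗ₜ[k] y) = wb.counit x • y := by
  simp [εid]

@[simp] lemma idε_tmul (x y : H) : wb.idε (x ⊗ₜ[k] y) = wb.counit y • x := by
  simp [idε]

lemma projL_apply (x : H) : wb.projL x = wb.εid (wb.comul 1 * (x ⊗ₜ[k] (1 : H))) := rfl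

lemma projR_apply (x : H) : wb.projR x = wb.idε (((1 : H) ⊗ₜ[k] x) * wb.comul 1) := rfl

/-- `x ⊗ y ⊗ z ↦ ε(x t) y ⊗ z`. -/
def evalLeft (t : H) : H ⊗[k] (H ⊗[k] H) →ₗ[k] H ⊗[k] H :=
  (TensorProduct.lid k (H ⊗[k] H)).toLinearMap ∘ₗ
    rTensor (H ⊗[k] H) (wb.counit ∘ₗ mulRight k t)

@[simp] lemma evalLeft_tmul (t x : H) (v : H ⊗[k] H) :
    wb.evalLeft t (x ⊗ₜ[k] v) = wb.counit (x * t) • v := by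
  simp [evalLeft]

lemma evalLeft_lTensor_comul (t : H) (u : H ⊗[k] H) :
    wb.evalLeft t (lTensor H wb.comul u) = wb.comul (wb.εid (u * (t ⊗ₜ[k] (1 : H)))) := by
  induction u with
  | zero => simp
  | tmul x y => simp
  | add u v hu hv => simp only [map_add, add_mul, hu, hv]

lemma evalLeft_assoc_mul (t : H) (u v : H ⊗[k] H) :
    wb.evalLeft t ((TensorProduct.assoc k H H H) (u ⊗ₜ[k] (1 : H)) * ((1 : H) ⊗ₜ[k] v))
      = (wb.εid (u * (t ⊗ₜ[k] (1 : H))) ⊗ₜ[k] (1 : H)) * v := by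
  induction u with
  | zero => simp
  | tmul x y => simp [← TensorProduct.smul_tmul']
  | add u w hu hw => simp only [TensorProduct.add_tmul, map_add, add_mul, hu, hw]

lemma evalLeft_mul_assoc (t : H) (u v : H ⊗[k] H) :
    wb.evalLeft t (((1 : H) ⊗ₜ[k] v) * (TensorProduct.assoc k H H H) (u ⊗ₜ[k] (1 : H)))
      = v * (wb.εid (u * (t ⊗ₜ[k] (1 : H))) ⊗ₜ[k] (1 : H)) := by
  induction u with
  | zero => simp
  | tmul x y => simp [← TensorProduct.smul_tmul']
  | add u w hu hw => simp only [TensorProduct.add_tmul, map_add, add_mul, mul_add, hu, hw]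

lemma comul_projL_eq_projL_mul (x : H) :
    wb.comul (wb.projL x) = (wb.projL x ⊗ₜ[k] (1 : H)) * wb.comul 1 := by
  rw [projL_apply, ← evalLeft_lTensor_comul, weak_one₁, evalLeft_assoc_mul]

lemma comul_projL_eq_mul_projL (x : H) :
    wb.comul (wb.projL x) = wb.comul 1 * (wb.projL x ⊗ₜ[k] (1 : H)) := by
  rw [projL_apply, ← evalLeft_lTensor_comul, weak_one₂, evalLeft_mul_assoc]

end WeakBialgebra

namespace ComodAlg

variable {k : Type*} [Field k] {H : Type*} [Ring H] [Algebra k H] [FiniteDimensional k H]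
variable {wb : WeakBialgebra k H} {A : Type*} [Ring A] [Algebra k A] (ca : ComodAlg wb A)

lemma mul_rho_one (a : A) : ca.ρ a * ca.ρ 1 = ca.ρ a := by rw [← ca.mul, mul_one]

lemma rho_one_mul (a : A) : ca.ρ 1 * ca.ρ a = ca.ρ a := by rw [← ca.mul, one_mul]

lemma lTensor_projL_rho_one : lTensor A wb.projL (ca.ρ 1) = ca.ρ 1 := by
  rw [ca.piL, ← Algebra.TensorProduct.one_def, mul_one]

lemma lTensor_comul_projL_eq_mul_comul_one (u : A ⊗[k] H) :
    lTensor A wb.comul (lTensor A wb.projL u)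
      = (TensorProduct.assoc k A H H) (lTensor A wb.projL u ⊗ₜ[k] (1 : H))
          * ((1 : A) ⊗ₜ[k] wb.comul 1) := by
  induction u with
  | zero => simp
  | tmul a x => simp [← wb.comul_projL_eq_projL_mul]
  | add u v hu hv => simp only [TensorProduct.add_tmul, map_add, add_mul, hu, hv]

lemma lTensor_comul_projL_eq_comul_one_mul (u : A ⊗[k] H) :
    lTensor A wb.comul (lTensor A wb.projL u)
      = ((1 : A) ⊗ₜ[k] wb.comul 1)
          * (TensorProduct.assoc k A H H) (lTensor A wb.projL u ⊗ₜ[k] (1 : H)) := by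
  induction u with
  | zero => simp
  | tmul a x => simp [← wb.comul_projL_eq_mul_projL]
  | add u v hu hv => simp only [TensorProduct.add_tmul, map_add, mul_add, hu, hv]

lemma lTensor_comul_rho_one_eq_mul_comul_one :
    lTensor A wb.comul (ca.ρ 1)
      = (TensorProduct.assoc k A H H) (ca.ρ 1 ⊗ₜ[k] (1 : H)) * ((1 : A) ⊗ₜ[k] wb.comul 1) := by
  have h := lTensor_comul_projL_eq_mul_comul_one (wb := wb) (ca.ρ 1)
  rwa [lTensor_projL_rho_one] at h

lemma lTensor_comul_rho_one_eq_comul_one_mul :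
    lTensor A wb.comul (ca.ρ 1)
      = ((1 : A) ⊗ₜ[k] wb.comul 1) * (TensorProduct.assoc k A H H) (ca.ρ 1 ⊗ₜ[k] (1 : H)) := by
  have h := lTensor_comul_projL_eq_comul_one_mul (wb := wb) (ca.ρ 1)
  rwa [lTensor_projL_rho_one] at h

lemma lTensor_comul_tmul_mul (a : A) (h : H) (u : A ⊗[k] H) :
    lTensor A wb.comul ((a ⊗ₜ[k] h) * u) = (a ⊗ₜ[k] wb.comul h) * lTensor A wb.comul u := by
  induction u with
  | zero => simp
  | tmul b x => simp [wb.comul_mul]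
  | add u v hu hv => simp only [map_add, mul_add, hu, hv]

lemma lTensor_comul_tmul_mul_rho_one (h : H) :
    lTensor A wb.comul (((1 : A) ⊗ₜ[k] h) * ca.ρ 1)
      = ((1 : A) ⊗ₜ[k] wb.comul h) * (TensorProduct.assoc k A H H) (ca.ρ 1 ⊗ₜ[k] (1 : H)) := by
  rw [lTensor_comul_tmul_mul, lTensor_comul_rho_one_eq_comul_one_mul, ← mul_assoc,
    Algebra.TensorProduct.tmul_mul_tmul, ← wb.comul_mul, mul_one, mul_one]

lemma lTensor_comul_one_tmul (a : A) (u : A ⊗[k] H) :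
    lTensor A wb.comul ((a ⊗ₜ[k] (1 : H)) * u)
      = (a ⊗ₜ[k] (1 : H ⊗[k] H)) * lTensor A wb.comul u := by
  induction u with
  | zero => simp
  | tmul b x => simp
  | add u v hu hv => simp only [map_add, mul_add, hu, hv]

lemma assoc_mul_tmul (x y : H) (u : A ⊗[k] H) :
    (TensorProduct.assoc k A H H) ((((1 : A) ⊗ₜ[k] x) * u) ⊗ₜ[k] y)
      = ((1 : A) ⊗ₜ[k] (x ⊗ₜ[k] y)) * (TensorProduct.assoc k A H H) (u ⊗ₜ[k] (1 : H)) := by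
  induction u with
  | zero => simp
  | tmul b z => simp
  | add u v hu hv => simp only [TensorProduct.add_tmul, map_add, mul_add, hu, hv]

lemma mkA_surjective : Function.Surjective ca.mkA := Submodule.mkQ_surjective _

lemma mkA_mul_tmul {b : A} (hb : b ∈ ca.coinv) (a a' : A) :
    ca.mkA ((a * b) ⊗ₜ[k] a') = ca.mkA (a ⊗ₜ[k] (b * a')) := by
  rw [← sub_eq_zero, ← map_sub]
  exact (Submodule.Quotient.mk_eq_zero _).2 (Submodule.subset_span ⟨a, a', b, hb, rfl⟩)

lemma mul_rho_of_mem_coinv {b : A} (hb : b ∈ ca.coinv) (a a' : A) :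
    ca.ρ (a * b) * (a' ⊗ₜ[k] (1 : H)) = ca.ρ a * ((b * a') ⊗ₜ[k] (1 : H)) := by
  have hb' : ca.ρ b = ca.ρ 1 * (b ⊗ₜ[k] (1 : H)) := hb
  rw [ca.mul, hb', ← mul_assoc, ca.mul_rho_one, mul_assoc,
    Algebra.TensorProduct.tmul_mul_tmul, mul_one]

/-- The map `A ⊗ A → A ⊗ H`, `a ⊗ a' ↦ a₍₀₎ a' ⊗ a₍₁₎`. -/
def preTwist : A ⊗[k] A →ₗ[k] A ⊗[k] H :=
  LinearMap.mul' k (A ⊗[k] H) ∘ₗ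
    TensorProduct.map ca.ρ ((TensorProduct.mk k A H).flip 1)

@[simp] lemma preTwist_tmul (a a' : A) :
    ca.preTwist (a ⊗ₜ[k] a') = ca.ρ a * (a' ⊗ₜ[k] (1 : H)) := by
  simp [preTwist]

/-- The map `A ⊗_B A → A ⊗ H`, `a ⊗ a' ↦ a₍₀₎ a' ⊗ a₍₁₎`. -/
def twist : ca.QA →ₗ[k] A ⊗[k] H :=
  ca.rel.liftQ ca.preTwist <| Submodule.span_le.2 <| by
    rintro _ ⟨a, a', b, hb, rfl⟩
    simp only [SetLike.mem_coe, LinearMap.mem_ker, map_sub, preTwist_tmul]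
    rw [ca.mul_rho_of_mem_coinv hb, sub_self]

@[simp] lemma twist_mkA (a a' : A) :
    ca.twist (ca.mkA (a ⊗ₜ[k] a')) = ca.ρ a * (a' ⊗ₜ[k] (1 : H)) :=
  ca.preTwist_tmul a a'

/-- Left multiplication by `c` on `A ⊗_B A`. -/
def leftMul (c : A) : ca.QA →ₗ[k] ca.QA :=
  ca.rel.mapQ ca.rel (rTensor A (mulLeft k c)) <| Submodule.span_le.2 <| by
    rintro _ ⟨a, a', b, hb, rfl⟩
    refine Submodule.subset_span ⟨c * a, a', b, hb, ?_⟩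
    simp [mul_assoc]

@[simp] lemma leftMul_mkA (c a a' : A) :
    ca.leftMul c (ca.mkA (a ⊗ₜ[k] a')) = ca.mkA ((c * a) ⊗ₜ[k] a') := rfl

/-- An induction principle for `A ⊗_B A`. -/
lemma QA_induction {p : ca.QA → Prop} (hz : p 0)
    (ht : ∀ a a' : A, p (ca.mkA (a ⊗ₜ[k] a'))) (hp : ∀ q r, p q → p r → p (q + r))
    (q : ca.QA) : p q := by
  obtain ⟨w, rfl⟩ := ca.mkA_surjective q
  induction w with
  | zero => simpa using hz
  | tmul a a' => exact ht a a'
  | add u v hu hv => simpa using hp _ _ hu hv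

lemma leftMul_add (c d : A) (q : ca.QA) :
    ca.leftMul (c + d) q = ca.leftMul c q + ca.leftMul d q := by
  induction q using ca.QA_induction with
  | hz => simp
  | ht a a' => simp [add_mul, TensorProduct.add_tmul]
  | hp q r hq hr => simp only [map_add, hq, hr]; abel

lemma leftMul_smul (s : k) (c : A) (q : ca.QA) :
    ca.leftMul (s • c) q = s • ca.leftMul c q := by
  induction q using ca.QA_induction with
  | hz => simp
  | ht a a' => simp [← TensorProduct.smul_tmul']
  | hp q r hq hr => simp only [map_add, hq, hr, smul_add]

/-- The left action of `A` on `A ⊗_B A`. -/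
def leftAction : A →ₗ[k] ca.QA →ₗ[k] ca.QA where
  toFun := ca.leftMul
  map_add' c d := LinearMap.ext (ca.leftMul_add c d)
  map_smul' s c := LinearMap.ext (ca.leftMul_smul s c)

@[simp] lemma leftAction_apply (c : A) : ca.leftAction c = ca.leftMul c := rfl

lemma twist_leftMul (c : A) (q : ca.QA) : ca.twist (ca.leftMul c q) = ca.ρ c * ca.twist q := by
  induction q using ca.QA_induction with
  | hz => simp
  | ht a a' => simp [ca.mul, mul_assoc]
  | hp q r hq hr => simp only [map_add, hq, hr, mul_add]

lemma rho_one_mul_twist (q : ca.QA) : ca.ρ 1 * ca.twist q = ca.twist q := by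
  induction q using ca.QA_induction with
  | hz => simp
  | ht a a' => rw [twist_mkA, ← mul_assoc, ca.rho_one_mul]
  | hp q r hq hr => simp only [map_add, hq, hr, mul_add]

/-- The map `q ⊗ x ↦ twist q · (1 ⊗ x)`. -/
def twistRight : ca.QA →ₗ[k] H →ₗ[k] A ⊗[k] H :=
  (LinearMap.mul k (A ⊗[k] H)).compl₁₂ ca.twist (TensorProduct.mk k A H 1)

@[simp] lemma twistRight_apply (q : ca.QA) (x : H) :
    ca.twistRight q x = ca.twist q * ((1 : A) ⊗ₜ[k] x) := rfl

/-- The map `q ⊗ x ↦ (1 ⊗ x) · twist q`. -/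
def twistLeft : ca.QA →ₗ[k] H →ₗ[k] A ⊗[k] H :=
  ((LinearMap.mul k (A ⊗[k] H)).compl₁₂ (TensorProduct.mk k A H 1) ca.twist).flip

@[simp] lemma twistLeft_apply (q : ca.QA) (x : H) :
    ca.twistLeft q x = ((1 : A) ⊗ₜ[k] x) * ca.twist q := rfl

/-- The map `A ⊗ A → (A ⊗_B A) ⊗ H`, `a ⊗ a' ↦ (a ⊗ a'₍₀₎) ⊗ a'₍₁₎`. -/
def rightCoaction : A ⊗[k] A →ₗ[k] ca.QA ⊗[k] H :=
  rTensor H ca.mkA ∘ₗ (TensorProduct.assoc k A A H).symm.toLinearMap ∘ₗ lTensor A ca.ρ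

lemma rightCoaction_tmul (a a' : A) :
    ca.rightCoaction (a ⊗ₜ[k] a')
      = rTensor H (ca.mkA ∘ₗ TensorProduct.mk k A A a) (ca.ρ a') := by
  simp only [rightCoaction, LinearMap.comp_apply, lTensor_tmul, LinearEquiv.coe_coe]
  induction ca.ρ a' with
  | zero => simp
  | tmul b x => simp
  | add u v hu hv => simp only [TensorProduct.tmul_add, map_add, hu, hv]

lemma lift_twistRight_rightCoaction (w : A ⊗[k] A) :
    TensorProduct.lift ca.twistRight (ca.rightCoaction w) = ca.ρ (LinearMap.mul' k A w) := by
  induction w with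
  | zero => simp
  | tmul a a' =>
    rw [rightCoaction_tmul, LinearMap.mul'_apply, ca.mul]
    induction ca.ρ a' with
    | zero => simp
    | tmul b x => simp [mul_assoc]
    | add u v hu hv => simp only [map_add, mul_add, hu, hv]
  | add u v hu hv => simp only [map_add, hu, hv]

/-- `a ⊗ x ⊗ y ↦ ε(h y) a ⊗ x`. -/
def evalRight (wb : WeakBialgebra k H) (A : Type*) [Ring A] [Algebra k A] (h : H) :
    A ⊗[k] (H ⊗[k] H) →ₗ[k] A ⊗[k] H :=
  lTensor A (wb.idε ∘ₗ lTensor H (mulLeft k h))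

lemma evalRight_assoc_rTensor (h : H) (f : A →ₗ[k] A ⊗[k] H) (u : A ⊗[k] H) :
    evalRight wb A h ((TensorProduct.assoc k A H H) (rTensor H f u))
      = f ((TensorProduct.rid k A) (lTensor A wb.counit (((1 : A) ⊗ₜ[k] h) * u))) := by
  induction u with
  | zero => simp
  | tmul a x =>
    simp only [rTensor_tmul, Algebra.TensorProduct.tmul_mul_tmul, one_mul, lTensor_tmul,
      TensorProduct.rid_tmul, map_smul]
    induction f a with
    | zero => simp
    | tmul b y => simp [evalRight]
    | add u v hu hv => simp only [TensorProduct.add_tmul, map_add, smul_add, hu, hv]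
  | add u v hu hv => simp only [map_add, mul_add, hu, hv]

lemma evalRight_assoc_mul (h : H) (u : A ⊗[k] H) (v : H ⊗[k] H) :
    evalRight wb A h ((TensorProduct.assoc k A H H) (u ⊗ₜ[k] (1 : H)) * ((1 : A) ⊗ₜ[k] v))
      = u * ((1 : A) ⊗ₜ[k] wb.idε (((1 : H) ⊗ₜ[k] h) * v)) := by
  induction u with
  | zero => simp
  | tmul a x =>
    induction v with
    | zero => simp
    | tmul p q => simp [evalRight]
    | add u v hu hv => simp only [TensorProduct.tmul_add, map_add, mul_add, hu, hv]
  | add u w hu hw => simp only [TensorProduct.add_tmul, map_add, add_mul, hu, hw]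

lemma rho_rid_counit_tmul_mul_rho_one (h : H) :
    ca.ρ ((TensorProduct.rid k A) (lTensor A wb.counit (((1 : A) ⊗ₜ[k] h) * ca.ρ 1)))
      = ca.ρ 1 * ((1 : A) ⊗ₜ[k] wb.projR h) := by
  rw [← evalRight_assoc_rTensor, ca.coassoc, lTensor_comul_rho_one_eq_mul_comul_one,
    evalRight_assoc_mul, wb.projR_apply]

lemma rid_counit_galois
    {β : ca.QA →ₗ[k] A ⊗[k] H}
    (hβ : ∀ a a' : A, β (ca.mkA (a ⊗ₜ[k] a')) = (a ⊗ₜ[k] (1 : H)) * ca.ρ a')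
    (w : A ⊗[k] A) :
    (TensorProduct.rid k A) (lTensor A wb.counit (β (ca.mkA w))) = LinearMap.mul' k A w := by
  induction w with
  | zero => simp
  | tmul a a' =>
    rw [hβ, LinearMap.mul'_apply]
    conv_rhs => rw [← ca.counital a']
    induction ca.ρ a' with
    | zero => simp
    | tmul b x => simp
    | add u v hu hv => simp only [map_add, mul_add, hu, hv]
  | add u v hu hv => simp only [map_add, hu, hv]

lemma assoc_rTensor_galois_rightCoaction
    {β : ca.QA →ₗ[k] A ⊗[k] H}
    (hβ : ∀ a a' : A, β (ca.mkA (a ⊗ₜ[k] a')) = (a ⊗ₜ[k] (1 : H)) * ca.ρ a')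
    (w : A ⊗[k] A) :
    (TensorProduct.assoc k A H H) (rTensor H β (ca.rightCoaction w))
      = lTensor A wb.comul (β (ca.mkA w)) := by
  induction w with
  | zero => simp
  | tmul a a' =>
    rw [rightCoaction_tmul, hβ, lTensor_comul_one_tmul, ← ca.coassoc]
    induction ca.ρ a' with
    | zero => simp
    | tmul b x =>
      simp only [rTensor_tmul, LinearMap.comp_apply, TensorProduct.mk_apply, hβ]
      induction ca.ρ b with
      | zero => simp
      | tmul c y => simp
      | add u v hu hv => simp only [TensorProduct.add_tmul, map_add, mul_add, hu, hv]
    | add u v hu hv => simp only [map_add, mul_add, hu, hv]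
  | add u v hu hv => simp only [map_add, hu, hv]

lemma galois_leftMul
    {β : ca.QA →ₗ[k] A ⊗[k] H}
    (hβ : ∀ a a' : A, β (ca.mkA (a ⊗ₜ[k] a')) = (a ⊗ₜ[k] (1 : H)) * ca.ρ a')
    (c : A) (q : ca.QA) :
    β (ca.leftMul c q) = (c ⊗ₜ[k] (1 : H)) * β q := by
  induction q using ca.QA_induction with
  | hz => simp
  | ht a a' => simp [hβ, ← mul_assoc]
  | hp q r hq hr => simp only [map_add, hq, hr, mul_add]

lemma assoc_rTensor_galois_translation
    {β : ca.QA →ₗ[k] A ⊗[k] H}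
    {γ : H →ₗ[k] ca.QA}
    (hγ : ∀ h : H, β (γ h) = ((1 : A) ⊗ₜ[k] h) * ca.ρ 1)
    (u : H ⊗[k] H) :
    (TensorProduct.assoc k A H H) (rTensor H β (rTensor H γ u))
      = ((1 : A) ⊗ₜ[k] u) * (TensorProduct.assoc k A H H) (ca.ρ 1 ⊗ₜ[k] (1 : H)) := by
  induction u with
  | zero => simp
  | tmul x y => simp only [rTensor_tmul, hγ, assoc_mul_tmul]
  | add u v hu hv => simp only [TensorProduct.tmul_add, map_add, add_mul, hu, hv]

/-- The translation map is right `H`-colinear. -/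
lemma rTensor_translation_comul
    {β : ca.QA →ₗ[k] A ⊗[k] H}
    (hβ : ∀ a a' : A, β (ca.mkA (a ⊗ₜ[k] a')) = (a ⊗ₜ[k] (1 : H)) * ca.ρ a')
    (hinj : Function.Injective β)
    {γ : H →ₗ[k] ca.QA}
    (hγ : ∀ h : H, β (γ h) = ((1 : A) ⊗ₜ[k] h) * ca.ρ 1)
    {h : H} {w : A ⊗[k] A} (hw : ca.mkA w = γ h) :
    rTensor H γ (wb.comul h) = ca.rightCoaction w := by
  refine Module.Flat.rTensor_preserves_injective_linearMap (M := H) β hinj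
    ((TensorProduct.assoc k A H H).injective ?_)
  rw [ca.assoc_rTensor_galois_translation hγ, ca.assoc_rTensor_galois_rightCoaction hβ, hw, hγ,
    lTensor_comul_tmul_mul_rho_one]

theorem lift_twistRight_translation
    {β : ca.QA →ₗ[k] A ⊗[k] H}
    (hβ : ∀ a a' : A, β (ca.mkA (a ⊗ₜ[k] a')) = (a ⊗ₜ[k] (1 : H)) * ca.ρ a')
    (hinj : Function.Injective β)
    {γ : H →ₗ[k] ca.QA}
    (hγ : ∀ h : H, β (γ h) = ((1 : A) ⊗ₜ[k] h) * ca.ρ 1)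
    (h : H) :
    TensorProduct.lift ca.twistRight (rTensor H γ (wb.comul h))
      = ca.ρ 1 * ((1 : A) ⊗ₜ[k] wb.projR h) := by
  obtain ⟨w, hw⟩ := ca.mkA_surjective (γ h)
  rw [ca.rTensor_translation_comul hβ hinj hγ hw, lift_twistRight_rightCoaction,
    ← ca.rid_counit_galois hβ, hw, hγ, rho_rid_counit_tmul_mul_rho_one]

/-- `Σ a₍₀₎ ℓᵢ(a₍₁₎) ⊗_B rᵢ(a₍₁₎) = 1 ⊗_B a`. -/
lemma lift_leftAction_translation_rho
    {β : ca.QA →ₗ[k] A ⊗[k] H}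
    (hβ : ∀ a a' : A, β (ca.mkA (a ⊗ₜ[k] a')) = (a ⊗ₜ[k] (1 : H)) * ca.ρ a')
    (hinj : Function.Injective β)
    {γ : H →ₗ[k] ca.QA}
    (hγ : ∀ h : H, β (γ h) = ((1 : A) ⊗ₜ[k] h) * ca.ρ 1)
    (a : A) :
    TensorProduct.lift (ca.leftAction.compl₂ γ) (ca.ρ a) = ca.mkA ((1 : A) ⊗ₜ[k] a) := by
  apply hinj
  have key (u : A ⊗[k] H) :
      β (TensorProduct.lift (ca.leftAction.compl₂ γ) u) = u * ca.ρ 1 := by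
    induction u with
    | zero => simp
    | tmul b x => simp [ca.galois_leftMul hβ, hγ, ← mul_assoc]
    | add u v hu hv => simp only [map_add, add_mul, hu, hv]
  rw [key, ca.mul_rho_one, hβ, ← Algebra.TensorProduct.one_def, one_mul]

/-- The map `A ⊗ H ⊗ H → A ⊗ H`, `a ⊗ x ⊗ h ↦ (a ⊗ x) · twist (γ h)`. -/
def mulTwist (γ : H →ₗ[k] ca.QA) : A ⊗[k] (H ⊗[k] H) →ₗ[k] A ⊗[k] H :=
  TensorProduct.lift ((LinearMap.mul k (A ⊗[k] H)).compl₂ (ca.twist ∘ₗ γ)) ∘ₗ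
    (TensorProduct.assoc k A H H).symm.toLinearMap

lemma mulTwist_assoc (γ : H →ₗ[k] ca.QA) (u : A ⊗[k] H) (h : H) :
    ca.mulTwist γ ((TensorProduct.assoc k A H H) (u ⊗ₜ[k] h)) = u * ca.twist (γ h) := by
  simp [mulTwist]

lemma mulTwist_tmul_mul (γ : H →ₗ[k] ca.QA) (a : A) (v : A ⊗[k] (H ⊗[k] H)) :
    ca.mulTwist γ ((a ⊗ₜ[k] (1 : H ⊗[k] H)) * v) = (a ⊗ₜ[k] (1 : H)) * ca.mulTwist γ v := by
  obtain ⟨v, rfl⟩ := (TensorProduct.assoc k A H H).surjective v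
  induction v with
  | zero => simp
  | tmul u h =>
    rw [mulTwist_assoc, ← mul_assoc, ← mulTwist_assoc]
    congr 1
    induction u with
    | zero => simp
    | tmul b x => simp
    | add u v hu hv => simp only [TensorProduct.add_tmul, map_add, mul_add, hu, hv]
  | add u v hu hv => simp only [map_add, mul_add, hu, hv]

lemma mulTwist_assoc_rTensor_rho (γ : H →ₗ[k] ca.QA) (u : A ⊗[k] H) :
    ca.mulTwist γ ((TensorProduct.assoc k A H H) (rTensor H ca.ρ u))
      = ca.twist (TensorProduct.lift (ca.leftAction.compl₂ γ) u) := by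
  induction u with
  | zero => simp
  | tmul a x => simp [mulTwist_assoc, twist_leftMul]
  | add u v hu hv => simp only [map_add, hu, hv]

lemma mulTwist_tmul_mul_rho_one (γ : H →ₗ[k] ca.QA) (u : H ⊗[k] H) :
    ca.mulTwist γ
        (((1 : A) ⊗ₜ[k] u) * (TensorProduct.assoc k A H H) (ca.ρ 1 ⊗ₜ[k] (1 : H)))
      = TensorProduct.lift ca.twistLeft.flip (lTensor H γ u) := by
  induction u with
  | zero => simp
  | tmul x y =>
    rw [← assoc_mul_tmul, mulTwist_assoc, mul_assoc, rho_one_mul_twist]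
    simp
  | add u v hu hv => simp only [TensorProduct.tmul_add, map_add, add_mul, hu, hv]

lemma lTensor_projL_tmul_mul (a : A) (u : A ⊗[k] H) :
    lTensor A wb.projL ((a ⊗ₜ[k] (1 : H)) * u) = (a ⊗ₜ[k] (1 : H)) * lTensor A wb.projL u := by
  induction u with
  | zero => simp
  | tmul b x => simp
  | add u v hu hv => simp only [map_add, mul_add, hu, hv]

lemma lTensor_projL_mulLeft (h : H) (u : A ⊗[k] H) :
    lTensor A wb.projL (((1 : A) ⊗ₜ[k] h) * u) = lTensor A (wb.projL ∘ₗ mulLeft k h) u := by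
  induction u with
  | zero => simp
  | tmul b x => simp
  | add u v hu hv => simp only [map_add, mul_add, hu, hv]

lemma mulTwist_comul_galois {β : ca.QA →ₗ[k] A ⊗[k] H}
    (hβ : ∀ a a' : A, β (ca.mkA (a ⊗ₜ[k] a')) = (a ⊗ₜ[k] (1 : H)) * ca.ρ a')
    (hinj : Function.Injective β) {γ : H →ₗ[k] ca.QA}
    (hγ : ∀ h : H, β (γ h) = ((1 : A) ⊗ₜ[k] h) * ca.ρ 1) (q : ca.QA) :
    ca.mulTwist γ (lTensor A wb.comul (β q)) = lTensor A wb.projL (β q) := by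
  induction q using ca.QA_induction with
  | hz => simp
  | ht a a' =>
    rw [hβ, lTensor_comul_one_tmul, mulTwist_tmul_mul, ← ca.coassoc, mulTwist_assoc_rTensor_rho,
      ca.lift_leftAction_translation_rho hβ hinj hγ, twist_mkA, lTensor_projL_tmul_mul, ca.piL]
  | hp q r hq hr => simp only [map_add, hq, hr]

theorem lift_twistLeft_translation {β : ca.QA →ₗ[k] A ⊗[k] H}
    (hβ : ∀ a a' : A, β (ca.mkA (a ⊗ₜ[k] a')) = (a ⊗ₜ[k] (1 : H)) * ca.ρ a')
    (hinj : Function.Injective β) {γ : H →ₗ[k] ca.QA}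
    (hγ : ∀ h : H, β (γ h) = ((1 : A) ⊗ₜ[k] h) * ca.ρ 1) (h : H) :
    TensorProduct.lift ca.twistLeft.flip (lTensor H γ (wb.comul h))
      = lTensor A (wb.projL ∘ₗ mulLeft k h) (ca.ρ 1) := by
  rw [← mulTwist_tmul_mul_rho_one, ← lTensor_comul_tmul_mul_rho_one, ← hγ,
    ca.mulTwist_comul_galois hβ hinj hγ, hγ, lTensor_projL_mulLeft]

end ComodAlg

/-- let `H` be a weak bialgebra and `A` a right `H`-comodule algebra with
coinvariants `B` whose Galois map `β : A ⊗_B A → (A ⊗ H)ρ(1)` is bijective.  Writing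
`β⁻¹(1₍₀₎ ⊗ h1₍₁₎) = Σᵢ ℓᵢ(h) ⊗_B rᵢ(h)`, the following identities hold in `A ⊗ H`:
`Σᵢ ℓᵢ(h₍₁₎)₍₀₎ rᵢ(h₍₁₎) ⊗ ℓᵢ(h₍₁₎)₍₁₎ h₍₂₎ = 1₍₀₎ ⊗ 1₍₁₎ Π^R(h)` and
`Σᵢ ℓᵢ(h₍₂₎)₍₀₎ rᵢ(h₍₂₎) ⊗ h₍₁₎ ℓᵢ(h₍₂₎)₍₁₎ = 1₍₀₎ ⊗ Π^L(h1₍₁₎)`; the expressions are well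
defined since for each `x ∈ H` the maps `a ⊗ a' ↦ a₍₀₎a' ⊗ a₍₁₎x` and
`a ⊗ a' ↦ a₍₀₎a' ⊗ x a₍₁₎` descend from `A ⊗_k A` to `A ⊗_B A`. -/
theorem statement16 {k : Type*} [Field k] {H : Type*} [Ring H] [Algebra k H]
    [FiniteDimensional k H] (wb : WeakBialgebra k H)
    {A : Type*} [Ring A] [Algebra k A] (ca : ComodAlg wb A)
    (β : ca.QA →ₗ[k] A ⊗[k] H)
    (hβ : ∀ a a' : A, β (ca.mkA (a ⊗ₜ[k] a')) = (a ⊗ₜ[k] (1 : H)) * ca.ρ a')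
    (hinj : Function.Injective β)
    (hrange : Set.range ⇑β = Set.range (fun w : A ⊗[k] H => w * ca.ρ 1))
    -- `γ h = β⁻¹(1₍₀₎ ⊗ h1₍₁₎)`
    (γ : H →ₗ[k] ca.QA)
    (hγ : ∀ h : H, β (γ h) = ((1 : A) ⊗ₜ[k] h) * ca.ρ 1) :
    -- the two maps `A ⊗_B A → A ⊗ H` (depending bilinearly on `x ∈ H`) are well defined ...
    ∃ Ξ Ξ' : ca.QA →ₗ[k] H →ₗ[k] A ⊗[k] H,
      (∀ (a a' : A) (x : H), Ξ (ca.mkA (a ⊗ₜ[k] a')) x = ca.ρ a * (a' ⊗ₜ[k] x)) ∧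
      (∀ (a a' : A) (x : H), Ξ' (ca.mkA (a ⊗ₜ[k] a')) x
        = ((1 : A) ⊗ₜ[k] x) * ca.ρ a * (a' ⊗ₜ[k] (1 : H))) ∧
      -- ... and `Σᵢ ℓᵢ(h₍₁₎)₍₀₎ rᵢ(h₍₁₎) ⊗ ℓᵢ(h₍₁₎)₍₁₎ h₍₂₎ = 1₍₀₎ ⊗ 1₍₁₎ Π^R(h)`
      (∀ h : H, (TensorProduct.lift Ξ) ((LinearMap.rTensor H γ) (wb.comul h))
        = ca.ρ 1 * ((1 : A) ⊗ₜ[k] wb.projR h)) ∧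
      -- and `Σᵢ ℓᵢ(h₍₂₎)₍₀₎ rᵢ(h₍₂₎) ⊗ h₍₁₎ ℓᵢ(h₍₂₎)₍₁₎ = 1₍₀₎ ⊗ Π^L(h1₍₁₎)`
      (∀ h : H, (TensorProduct.lift Ξ'.flip) ((LinearMap.lTensor H γ) (wb.comul h))
        = (LinearMap.lTensor A (wb.projL ∘ₗ LinearMap.mulLeft k h)) (ca.ρ 1)) := by
  refine ⟨ca.twistRight, ca.twistLeft, fun a a' x => ?_, fun a a' x => ?_,
    ca.lift_twistRight_translation hβ hinj hγ, ca.lift_twistLeft_translation hβ hinj hγ⟩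
  · rw [ca.twistRight_apply, ca.twist_mkA, mul_assoc, Algebra.TensorProduct.tmul_mul_tmul,
      mul_one, one_mul]
  · rw [ca.twistLeft_apply, ca.twist_mkA, mul_assoc]
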